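/- arXiv:1112.5589 — 5 statements merged into one kernel-verified Lean document; each statement's English description precedes it below -/
import Mathlib

section
/- (Duality.) Let d ≥ 1, let 𝔪 = (c₀, C, C̃, U) ∈ 𝔐_d, let β be a complex number that is not a nonpositive integer, and set 𝔪̃ = (c₀, C̃, C, Uᵗ) ∈ 𝔐_d. Then for all n, x ∈ ℕ₀^d, P_n(x; 𝔪, β) = P_x(n; 𝔪̃, β). -/
open Finset Matrix

/-- Membership of a 4-tuple `(c₀, C, C̃, U)` in the set `𝔐_d`. -/
def MeixnerMem (d : ℕ) (c0 : ℂ) (c ct : Fin d → ℂ)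
    (U : Matrix (Fin (d + 1)) (Fin (d + 1)) ℂ) : Prop :=
  c0 ≠ 0 ∧ (∀ j, U 0 j = 1) ∧ (∀ i, U i 0 = 1) ∧
    U.transpose * Matrix.diagonal (Fin.cons (1 : ℂ) (fun k => -c k)) * U *
      Matrix.diagonal (Fin.cons (1 : ℂ) (fun k => -ct k)) =
      c0 • (1 : Matrix (Fin (d + 1)) (Fin (d + 1)) ℂ)

/-- The multivariate Meixner polynomial (3.1); it depends on `𝔪` only through `U`. -/
noncomputable def meixnerP (d : ℕ) (U : Matrix (Fin (d + 1)) (Fin (d + 1)) ℂ)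
    (β : ℂ) (n : Fin d → ℕ) (x : Fin d → ℂ) : ℂ :=
  ∑ A ∈ (Fintype.piFinset fun _ : Fin d =>
        Fintype.piFinset fun j : Fin d => Finset.range (n j + 1)).filter
      (fun A : Fin d → Fin d → ℕ => ∀ j, ∑ i, A i j ≤ n j),
    (∏ j, (ascPochhammer ℂ (∑ i, A i j)).eval (-(n j : ℂ))) *
        (∏ i, (ascPochhammer ℂ (∑ j, A i j)).eval (-(x i))) /
        (ascPochhammer ℂ (∑ i, ∑ j, A i j)).eval β *
      ∏ i, ∏ j, (1 - U i.succ j.succ) ^ (A i j) / (Nat.factorial (A i j) : ℂ)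

/-- Corollary 3.2 (duality): `P_n(x;𝔪,β) = P_x(n;𝔪̃,β)` for all `n, x ∈ ℕ₀^d`,
where `𝔪̃ = 𝔟(𝔪) = (c₀, C̃, C, Uᵗ)`. -/
theorem meixner_duality (d : ℕ) (hd : 1 ≤ d) (c0 : ℂ) (c ct : Fin d → ℂ)
    (U : Matrix (Fin (d + 1)) (Fin (d + 1)) ℂ) (hm : MeixnerMem d c0 c ct U)
    (β : ℂ) (hβ : ∀ k : ℕ, β ≠ -(k : ℂ)) (n x : Fin d → ℕ) :
    meixnerP d U β n (fun j => (x j : ℂ)) =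
      meixnerP d U.transpose β x (fun j => (n j : ℂ)) := by
  have key : ∀ (k m : ℕ), (ascPochhammer ℂ k).eval (-(m : ℂ)) ≠ 0 → k ≤ m := by
    intro k m h
    by_contra hlt
    exact h (ascPochhammer_eval_neg_coe_nat_of_lt (not_le.mp hlt))
  have mem : ∀ (m : Fin d → ℕ) (A : Fin d → Fin d → ℕ), (∀ j, ∑ i, A i j ≤ m j) →
      A ∈ (Fintype.piFinset fun _ : Fin d =>
        Fintype.piFinset fun j : Fin d => Finset.range (m j + 1)).filter
      (fun A : Fin d → Fin d → ℕ => ∀ j, ∑ i, A i j ≤ m j) := by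
    intro m A h
    simp only [Finset.mem_filter, Fintype.mem_piFinset, Finset.mem_range]
    refine ⟨fun i j => Nat.lt_succ_of_le (le_trans ?_ (h j)), h⟩
    exact Finset.single_le_sum (f := fun i => A i j) (fun _ _ => Nat.zero_le _)
      (Finset.mem_univ i)
  have term : ∀ A : Fin d → Fin d → ℕ,
      (∏ j, (ascPochhammer ℂ (∑ i, A i j)).eval (-(n j : ℂ))) *
        (∏ i, (ascPochhammer ℂ (∑ j, A i j)).eval (-(x i : ℂ))) /
        (ascPochhammer ℂ (∑ i, ∑ j, A i j)).eval β *
      ∏ i, ∏ j, (1 - U i.succ j.succ) ^ (A i j) / (Nat.factorial (A i j) : ℂ) =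
      (∏ j, (ascPochhammer ℂ (∑ i, A j i)).eval (-(x j : ℂ))) *
        (∏ i, (ascPochhammer ℂ (∑ j, A j i)).eval (-(n i : ℂ))) /
        (ascPochhammer ℂ (∑ i, ∑ j, A j i)).eval β *
      ∏ i, ∏ j, (1 - U.transpose i.succ j.succ) ^ (A j i) /
        (Nat.factorial (A j i) : ℂ) := by
    intro A
    rw [Finset.sum_comm (f := fun i j => A i j), Finset.prod_comm (f := fun i j =>
      (1 - U i.succ j.succ) ^ (A i j) / (Nat.factorial (A i j) : ℂ)), mul_comm (∏ j, _) (∏ i, _)]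
    rfl
  unfold meixnerP
  refine Finset.sum_bij_ne_zero (fun A _ _ => fun i j => A j i) ?_ ?_ ?_ ?_
  · intro A _ h
    refine mem x _ fun j => key _ _ ?_
    have h1 := right_ne_zero_of_mul (div_ne_zero_iff.mp (left_ne_zero_of_mul h)).1
    exact Finset.prod_ne_zero_iff.mp h1 j (Finset.mem_univ j)
  · intro A _ _ B _ _ h
    funext i j
    exact congrFun (congrFun h j) i
  · intro B _ h
    have h1 := right_ne_zero_of_mul (div_ne_zero_iff.mp (left_ne_zero_of_mul h)).1
    refine ⟨fun i j => B j i, mem n _ fun j => key _ _ ?_, ?_, rfl⟩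
    · exact Finset.prod_ne_zero_iff.mp h1 j (Finset.mem_univ j)
    · rw [term]
      exact h
  · intro A _ _
    exact term A
end

section
/- (Difference equation in the variables x.) Let d ≥ 1, let 𝔪 = (c₀, C, C̃, U) ∈ 𝔐_d, and let β be a complex number that is not a nonpositive integer. Then for every i ∈ {1,…,d}, every n ∈ ℕ₀^d, and every x ∈ ℂ^d, writing e_k for the k-th standard basis vector of ℂ^d and P_n(x) = P_n(x; 𝔪, β): (c̃_i/c₀) [ Σ_{1≤k≠l≤d} c_k u_{k,i} u_{l,i} x_l (P_n(x+e_k−e_l) − P_n(x)) − Σ_{l=1}^d u_{l,i} x_l (P_n(x−e_l) − P_n(x)) − Σ_{k=1}^d c_k u_{k,i} (β+|x|) (P_n(x+e_k) − P_n(x)) ] = n_i P_n(x), where |x| = x₁+…+x_d. -/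
open Finset Matrix

namespace MeixAux

noncomputable def phi {d : ℕ} (r : Fin d → ℕ) (x : Fin d → ℂ) : ℂ :=
  ∏ i, (ascPochhammer ℂ (r i)).eval (-(x i))

noncomputable def bb (β : ℂ) (m : ℕ) : ℂ := (ascPochhammer ℂ m).eval β

noncomputable def WW {d : ℕ} (w : Fin d → Fin d → ℂ) (A : Fin d → Fin d → ℕ) : ℂ :=
  ∏ i, ∏ j, (w i j) ^ (A i j) / (Nat.factorial (A i j) : ℂ)

def EE {d : ℕ} (k j : Fin d) : Fin d → Fin d → ℕ := Pi.single k (Pi.single j 1)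

def sig {d : ℕ} (A : Fin d → Fin d → ℕ) : Fin d → ℕ := fun j => ∑ i, A i j
def rho {d : ℕ} (A : Fin d → Fin d → ℕ) : Fin d → ℕ := fun i => ∑ j, A i j
def tot {d : ℕ} (A : Fin d → Fin d → ℕ) : ℕ := ∑ i, ∑ j, A i j

def SS {d : ℕ} (n : Fin d → ℕ) : Finset (Fin d → Fin d → ℕ) :=
  (Fintype.piFinset fun _ : Fin d =>
        Fintype.piFinset fun j : Fin d => Finset.range (n j + 1)).filter
      (fun A : Fin d → Fin d → ℕ => ∀ j, ∑ i, A i j ≤ n j)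

noncomputable def KK {d : ℕ} (w : Fin d → Fin d → ℂ) (β : ℂ) (n : Fin d → ℕ)
    (A : Fin d → Fin d → ℕ) : ℂ :=
  phi (sig A) (fun j => (n j : ℂ)) / bb β (tot A) * WW w A

lemma mem_SS {d : ℕ} (n : Fin d → ℕ) (A : Fin d → Fin d → ℕ) :
    A ∈ SS n ↔ ∀ j, sig A j ≤ n j := by
  unfold SS sig
  simp only [Finset.mem_filter, Fintype.mem_piFinset, Finset.mem_range]
  constructor
  · exact fun h => h.2
  · refine fun h => ⟨fun i j => ?_, h⟩
    have h1 := h j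
    have h2 : A i j ≤ ∑ i, A i j :=
      Finset.single_le_sum (f := fun i => A i j) (fun _ _ => Nat.zero_le _) (Finset.mem_univ i)
    omega

lemma sig_add {d : ℕ} (A : Fin d → Fin d → ℕ) (k j : Fin d) :
    sig (A + EE k j) = sig A + Pi.single j 1 := by
  funext j'
  simp only [sig, EE, Pi.add_apply, Finset.sum_add_distrib]
  congr 1
  rw [Finset.sum_eq_single k]
  · simp
  · intro b _ hb
    simp [Pi.single_eq_of_ne hb]
  · simp

lemma rho_add {d : ℕ} (A : Fin d → Fin d → ℕ) (k j : Fin d) :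
    rho (A + EE k j) = rho A + Pi.single k 1 := by
  funext i
  simp only [rho, EE, Pi.add_apply, Finset.sum_add_distrib]
  congr 1
  by_cases h : i = k
  · subst h; simp
  · simp [Pi.single_eq_of_ne h]

lemma tot_eq {d : ℕ} (A : Fin d → Fin d → ℕ) : tot A = ∑ k, rho A k := rfl

lemma tot_add {d : ℕ} (A : Fin d → Fin d → ℕ) (k j : Fin d) :
    tot (A + EE k j) = tot A + 1 := by
  rw [tot_eq, rho_add, tot_eq]
  simp [Finset.sum_add_distrib]

lemma bb_succ (β : ℂ) (m : ℕ) : bb β (m + 1) = bb β m * (β + m) := by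
  simp [bb, ascPochhammer_succ_right]

lemma bb_left (β : ℂ) (m : ℕ) : bb β (m + 1) = β * bb (β + 1) m := by
  simp [bb, ascPochhammer_succ_left, Polynomial.eval_comp]

lemma bb_ne (β : ℂ) (hβ : ∀ k : ℕ, β ≠ -(k : ℂ)) (m : ℕ) : bb β m ≠ 0 := by
  induction m with
  | zero => simp [bb]
  | succ m ih =>
    rw [bb_succ]
    refine mul_ne_zero ih fun h => hβ m (eq_neg_of_add_eq_zero_left h)

lemma prod_upd {d : ℕ} (f g : Fin d → ℂ) (k : Fin d) (a b : ℂ)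
    (h : ∀ i, i ≠ k → f i = g i) (hk : a * f k = b * g k) :
    a * ∏ i, f i = b * ∏ i, g i := by
  rw [← Finset.mul_prod_erase _ f (Finset.mem_univ k),
    ← Finset.mul_prod_erase _ g (Finset.mem_univ k), ← mul_assoc, ← mul_assoc, hk]
  congr 1
  exact Finset.prod_congr rfl fun i hi => h i (Finset.ne_of_mem_erase hi)

lemma WW_add {d : ℕ} (w : Fin d → Fin d → ℂ) (A : Fin d → Fin d → ℕ) (k j : Fin d) :
    ((A k j : ℂ) + 1) * WW w (A + EE k j) = w k j * WW w A := by
  unfold WW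
  apply prod_upd _ _ k
  · intro i hi
    simp [EE, Pi.single_eq_of_ne hi]
  · apply prod_upd _ _ j
    · intro i hi
      simp [EE, Pi.single_eq_of_ne hi]
    · have h1 : ((A k j : ℂ) + 1) ≠ 0 := Nat.cast_add_one_ne_zero _
      have h2 : ((A k j).factorial : ℂ) ≠ 0 := by exact_mod_cast Nat.factorial_ne_zero _
      simp only [EE, Pi.add_apply, Pi.single_eq_same, Nat.factorial_succ, pow_succ]
      push_cast
      field_simp

lemma phi_add {d : ℕ} (r : Fin d → ℕ) (x : Fin d → ℂ) (l : Fin d) :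
    phi (r + Pi.single l 1) x = (r l - x l) * phi r x := by
  unfold phi
  rw [← one_mul (∏ i, _)]
  apply prod_upd _ _ l
  · intro i hi
    simp [Pi.single_eq_of_ne hi]
  · have := bb_succ (-(x l)) (r l)
    simp only [bb] at this
    simp only [Pi.add_apply, Pi.single_eq_same]
    rw [this]; ring

/-- lowering shift -/
lemma phi_down {d : ℕ} (r : Fin d → ℕ) (x : Fin d → ℂ) (l : Fin d) :
    x l * phi r (fun j => x j - (if j = l then 1 else 0)) = - phi (r + Pi.single l 1) x := by
  rw [← neg_one_mul]
  unfold phi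
  apply prod_upd _ _ l
  · intro i hi
    simp [Pi.single_eq_of_ne hi, hi]
  · have := bb_left (-(x l)) (r l)
    simp only [bb] at this
    simp only [Pi.add_apply, Pi.single_eq_same, if_true]
    rw [this, show -(x l - 1) = -x l + 1 by ring]; ring

/-- raising shift -/
lemma phi_up {d : ℕ} (r : Fin d → ℕ) (x : Fin d → ℂ) (k : Fin d) :
    phi r (fun j => x j + (if j = k then 1 else 0)) =
      phi r x - r k * phi (r - Pi.single k 1) x := by
  have hs1 : (r - Pi.single k 1 : Fin d → ℕ) k = r k - 1 := by simp
  have hs2 : ∀ i, i ≠ k → (r - Pi.single k 1 : Fin d → ℕ) i = r i := fun i hi => by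
    simp [Pi.single_eq_of_ne hi]
  generalize (r - Pi.single k 1 : Fin d → ℕ) = s at hs1 hs2 ⊢
  unfold phi
  rw [← Finset.mul_prod_erase _ _ (Finset.mem_univ k),
    ← Finset.mul_prod_erase _ (fun i => Polynomial.eval (-x i) (ascPochhammer ℂ (r i))) (Finset.mem_univ k),
    ← Finset.mul_prod_erase _
      (fun i => Polynomial.eval (-x i) (ascPochhammer ℂ (s i)))
      (Finset.mem_univ k)]
  have e1 : ∏ i ∈ univ.erase k, (ascPochhammer ℂ (r i)).eval (-(x i + if i = k then 1 else 0))
      = ∏ i ∈ univ.erase k, (ascPochhammer ℂ (r i)).eval (-(x i)) :=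
    Finset.prod_congr rfl fun i hi => by simp [Finset.ne_of_mem_erase hi]
  have e2 : ∏ i ∈ univ.erase k, (ascPochhammer ℂ (s i)).eval (-(x i))
      = ∏ i ∈ univ.erase k, (ascPochhammer ℂ (r i)).eval (-(x i)) :=
    Finset.prod_congr rfl fun i hi => by
      rw [hs2 i (Finset.ne_of_mem_erase hi)]
  rw [e1, e2, ← mul_assoc, ← sub_mul]
  congr 1
  simp only [hs1, if_true]
  rcases hr : r k with _ | m
  · simp
  · have h1 := bb_left (-(x k + 1)) m
    have h2 := bb_succ (-(x k)) m
    simp only [bb] at h1 h2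
    rw [h1, h2, show -(x k + 1) + 1 = -x k by ring]
    simp only [Nat.add_sub_cancel]
    push_cast
    ring

lemma phi_mixed {d : ℕ} (r : Fin d → ℕ) (x : Fin d → ℂ) (k l : Fin d) (h : l ≠ k) :
    x l * phi r (fun j => x j + (if j = k then 1 else 0) - (if j = l then 1 else 0)) =
      - phi (r + Pi.single l 1) x + r k * phi (r - Pi.single k 1 + Pi.single l 1) x := by
  have h1 := phi_down r (fun j => x j + (if j = k then 1 else 0)) l
  simp only [h, if_false, add_zero] at h1
  rw [h1, phi_up]
  have e : r + Pi.single l 1 - Pi.single k 1 = r - Pi.single k 1 + Pi.single l 1 := by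
    funext i
    by_cases hi : i = l
    · subst hi; simp [Pi.single_eq_of_ne h]
    · simp [Pi.single_eq_of_ne hi]
  rw [e]
  simp [Pi.single_eq_of_ne h.symm]
  ring

/-- Action of the bracket on a basis element. -/
lemma bracket_phi {d : ℕ} (r : Fin d → ℕ) (x : Fin d → ℂ) (c u : Fin d → ℂ) (β : ℂ)
    (hcu : ∑ k, c k * u k = 1) :
    (∑ k : Fin d, ∑ l ∈ Finset.univ.erase k,
            c k * u k * u l * x l *
              (phi r (fun j => x j + (if j = k then 1 else 0) - (if j = l then 1 else 0)) -
                phi r x)) -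
          (∑ l : Fin d, u l * x l *
            (phi r (fun j => x j - (if j = l then 1 else 0)) - phi r x)) -
          ∑ k : Fin d, c k * u k * (β + ∑ j, x j) *
            (phi r (fun j => x j + (if j = k then 1 else 0)) - phi r x) =
    ∑ k, c k * u k * (r k * ((β + ∑ j, (((r - Pi.single k 1 : Fin d → ℕ) j : ℕ) : ℂ)) * phi (r - Pi.single k 1) x
      - ∑ l, (1 - u l) * phi (r - Pi.single k 1 + Pi.single l 1) x)) := by
  have h1 : ∀ k, ∑ l ∈ Finset.univ.erase k,
            c k * u k * u l * x l *
              (phi r (fun j => x j + (if j = k then 1 else 0) - (if j = l then 1 else 0)) -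
                phi r x) =
      ∑ l, c k * u k * u l * (r k * phi (r - Pi.single k 1 + Pi.single l 1) x - r l * phi r x) := by
    intro k
    rw [← Finset.sum_erase_add _ _ (Finset.mem_univ k)]
    have hz : (r k : ℂ) * phi (r - Pi.single k 1 + Pi.single k 1) x - r k * phi r x = 0 := by
      rcases hr : r k with _ | m
      · simp
      · have : r - Pi.single k 1 + Pi.single k 1 = r := by
          funext i
          by_cases hi : i = k
          · subst hi; simp [hr]
          · simp [Pi.single_eq_of_ne hi]
        rw [this]; ring
    rw [hz, mul_zero, add_zero]
    refine Finset.sum_congr rfl fun l hl => ?_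
    have := phi_mixed r x k l (Finset.ne_of_mem_erase hl)
    have h2 := phi_add r x l
    linear_combination (c k * u k * u l) * this - (c k * u k * u l) * h2
  have h2 : ∀ l, u l * x l * (phi r (fun j => x j - (if j = l then 1 else 0)) - phi r x) =
      - (u l * r l * phi r x) := by
    intro l
    linear_combination u l * phi_down r x l - u l * phi_add r x l
  have h3 : ∀ k, c k * u k * (β + ∑ j, x j) *
            (phi r (fun j => x j + (if j = k then 1 else 0)) - phi r x) =
      - (c k * u k * (r k * ((β + ∑ j, (((r - Pi.single k 1 : Fin d → ℕ) j : ℕ) : ℂ)) * phi (r - Pi.single k 1) x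
      - ∑ l, phi (r - Pi.single k 1 + Pi.single l 1) x))) := by
    intro k
    rw [phi_up]
    simp_rw [phi_add]
    rw [← Finset.sum_mul, Finset.sum_sub_distrib]
    ring
  simp_rw [h1, h2, h3, mul_sub, sub_mul, one_mul, Finset.sum_sub_distrib, Finset.sum_neg_distrib]
  have h4 : ∑ k, ∑ l, c k * u k * u l * (r l * phi r x) = ∑ l, u l * r l * phi r x := by
    rw [← one_mul (∑ l, u l * r l * phi r x), ← hcu, Finset.sum_mul_sum]
    refine Finset.sum_congr rfl fun k _ => Finset.sum_congr rfl fun l _ => by ring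
  have h5 : ∑ k, ∑ l, c k * u k * u l * (r k * phi (r - Pi.single k 1 + Pi.single l 1) x) =
      ∑ k, c k * u k * (r k * ∑ l, u l * phi (r - Pi.single k 1 + Pi.single l 1) x) := by
    refine Finset.sum_congr rfl fun k _ => ?_
    rw [Finset.mul_sum, Finset.mul_sum]
    refine Finset.sum_congr rfl fun l _ => by ring
  rw [h4, h5]
  simp only [mul_sub, Finset.sum_sub_distrib]
  ring

lemma KK_zero {d : ℕ} (w : Fin d → Fin d → ℂ) (β : ℂ) (n : Fin d → ℕ)
    (A : Fin d → Fin d → ℕ) (h : A ∉ SS n) : KK w β n A = 0 := by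
  rw [mem_SS] at h
  push Not at h
  obtain ⟨j, hj⟩ := h
  have : phi (sig A) (fun j => (n j : ℂ)) = 0 := by
    unfold phi
    refine Finset.prod_eq_zero (Finset.mem_univ j) ?_
    exact ascPochhammer_eval_neg_coe_nat_of_lt hj
  simp [KK, this]

lemma KK_add {d : ℕ} (w : Fin d → Fin d → ℂ) (β : ℂ) (hβ : ∀ k : ℕ, β ≠ -(k : ℂ))
    (n : Fin d → ℕ) (A : Fin d → Fin d → ℕ) (k j : Fin d) :
    ((A k j : ℂ) + 1) * KK w β n (A + EE k j) =
      w k j * (sig A j - n j) * KK w β n A / (β + tot A) := by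
  have h1 := bb_ne β hβ (tot A)
  have h2 : β + tot A ≠ 0 := fun h => hβ _ (eq_neg_of_add_eq_zero_left h)
  unfold KK
  rw [sig_add, tot_add, bb_succ, phi_add]
  have := WW_add w A k j
  field_simp
  linear_combination (phi (sig A) (fun j => (n j : ℂ)) * (sig A j - n j)) * this

lemma reindex {d : ℕ} (n : Fin d → ℕ) (f : (Fin d → Fin d → ℕ) → ℂ)
    (hf : ∀ A, A ∉ SS n → f A = 0) (k j : Fin d) :
    ∑ A ∈ SS n, (A k j : ℂ) * f A = ∑ B ∈ SS n, ((B k j : ℂ) + 1) * f (B + EE k j) := by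
  symm
  refine Finset.sum_bij_ne_zero (fun B _ _ => B + EE k j) ?_ ?_ ?_ ?_
  · intro B _ h
    by_contra hc
    exact h (by rw [hf _ hc, mul_zero])
  · intro a _ _ b _ _ h
    exact add_right_cancel h
  · intro A hA h
    have hA0 : A k j ≠ 0 := by
      intro h0; apply h; simp [h0]
    have e : A - EE k j + EE k j = A := by
      funext a b
      by_cases ha : a = k
      · subst ha
        by_cases hb : b = j
        · subst hb
          simp only [EE, Pi.add_apply, Pi.sub_apply, Pi.single_eq_same]
          omega
        · simp [EE, Pi.single_eq_of_ne hb]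
      · simp [EE, Pi.single_eq_of_ne ha]
    have hc : (((A - EE k j) k j : ℕ) : ℂ) + 1 = A k j := by
      have : (A - EE k j) k j + 1 = A k j := by
        simp only [EE, Pi.sub_apply, Pi.single_eq_same]; omega
      exact_mod_cast this
    refine ⟨A - EE k j, ?_, ?_, e⟩
    · rw [mem_SS] at hA ⊢
      intro b
      refine le_trans ?_ (hA b)
      refine Finset.sum_le_sum fun a _ => ?_
      simp [Pi.sub_apply]
    · rw [e, hc]; exact h
  · intro B _ _
    simp [EE]

lemma meixnerP_eq (d : ℕ) (U : Matrix (Fin (d + 1)) (Fin (d + 1)) ℂ)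
    (β : ℂ) (n : Fin d → ℕ) (x : Fin d → ℂ) :
    meixnerP d U β n x =
      ∑ A ∈ SS n, KK (fun i j => 1 - U i.succ j.succ) β n A * phi (rho A) x := by
  unfold meixnerP SS
  refine Finset.sum_congr rfl fun A _ => ?_
  simp only [KK, phi, sig, rho, tot, bb, WW]
  ring

lemma bracket_lin {d : ℕ} {ι : Type*} (S : Finset ι) (K : ι → ℂ) (p : ι → (Fin d → ℂ) → ℂ)
    (x : Fin d → ℂ) (c u : Fin d → ℂ) (b : ℂ) (P : (Fin d → ℂ) → ℂ)
    (hP : ∀ y, P y = ∑ A ∈ S, K A * p A y) :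
    (∑ k : Fin d, ∑ l ∈ Finset.univ.erase k,
            c k * u k * u l * x l *
              (P (fun j => x j + (if j = k then 1 else 0) - (if j = l then 1 else 0)) -
                P x)) -
          (∑ l : Fin d, u l * x l *
            (P (fun j => x j - (if j = l then 1 else 0)) - P x)) -
          ∑ k : Fin d, c k * u k * b *
            (P (fun j => x j + (if j = k then 1 else 0)) - P x) =
    ∑ A ∈ S, K A * ((∑ k : Fin d, ∑ l ∈ Finset.univ.erase k,
            c k * u k * u l * x l *
              (p A (fun j => x j + (if j = k then 1 else 0) - (if j = l then 1 else 0)) -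
                p A x)) -
          (∑ l : Fin d, u l * x l *
            (p A (fun j => x j - (if j = l then 1 else 0)) - p A x)) -
          ∑ k : Fin d, c k * u k * b *
            (p A (fun j => x j + (if j = k then 1 else 0)) - p A x)) := by
  have hd : ∀ (a : ℂ) y, a * (P y - P x) = ∑ A ∈ S, K A * (a * (p A y - p A x)) := by
    intro a y
    rw [hP, hP, ← Finset.sum_sub_distrib, Finset.mul_sum]
    exact Finset.sum_congr rfl fun A _ => by ring
  simp_rw [hd, mul_sub (K _), Finset.sum_sub_distrib]
  congr 1
  · congr 1
    · simp_rw [Finset.mul_sum (s := univ), Finset.mul_sum (s := univ.erase _)]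
      rw [Finset.sum_comm]
      refine Finset.sum_congr rfl fun k _ => ?_
      rw [Finset.sum_comm]
    · simp_rw [Finset.mul_sum (s := univ)]
      rw [Finset.sum_comm]
  · simp_rw [Finset.mul_sum (s := univ)]
    rw [Finset.sum_comm]

lemma mem_rel {d : ℕ} {c0 : ℂ} {c ct : Fin d → ℂ}
    {U : Matrix (Fin (d + 1)) (Fin (d + 1)) ℂ} (hm : MeixnerMem d c0 c ct U) (i : Fin d) :
    ct i ≠ 0 ∧ (∑ k, c k * U k.succ i.succ = 1) ∧
    ∀ j, ∑ k, c k * U k.succ i.succ * (1 - U k.succ j.succ) =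
      if j = i then - (c0 / ct i) else 0 := by
  obtain ⟨h0, hr, hc, h⟩ := hm
  have key : ∀ a b : Fin (d + 1), (1 - ∑ k : Fin d, c k * U k.succ a * U k.succ b) *
      (Fin.cons (1 : ℂ) (fun k => -ct k) : Fin (d + 1) → ℂ) b = if a = b then c0 else 0 := by
    intro a b
    have := congrFun (congrFun h a) b
    rw [Matrix.mul_diagonal, Matrix.mul_apply] at this
    simp only [Matrix.mul_diagonal, Fin.sum_univ_succ, Matrix.transpose_apply, hr,
      Fin.cons_zero, Fin.cons_succ, Matrix.smul_apply, Matrix.one_apply, smul_eq_mul] at this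
    rw [show (if a = b then c0 else 0) = c0 * (if a = b then 1 else 0) by simp, ← this]
    congr 1
    rw [sub_eq_add_neg, ← Finset.sum_neg_distrib]
    simp only [mul_one]
    congr 1
    exact Finset.sum_congr rfl fun k _ => by ring
  have hct : ∀ j, ct j ≠ 0 := by
    intro j hj
    have := key j.succ j.succ
    simp [hj] at this
    exact h0 this.symm
  have h1 : ∑ k, c k * U k.succ i.succ = 1 := by
    have := key i.succ 0
    simp only [hc, Fin.cons_zero, mul_one, Fin.succ_ne_zero, if_false] at this
    exact (sub_eq_zero.mp this).symm
  refine ⟨hct i, h1, fun j => ?_⟩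
  have := key i.succ j.succ
  simp only [Fin.cons_succ, Fin.succ_inj] at this
  simp_rw [mul_sub, mul_one, Finset.sum_sub_distrib, h1]
  have hj := hct j
  by_cases hji : j = i
  · subst hji
    simp only [if_true] at this ⊢
    rw [← neg_div, eq_div_iff hj]
    linear_combination -this
  · rw [if_neg hji]
    rw [if_neg (Ne.symm hji)] at this
    exact (mul_eq_zero.mp this).resolve_right (neg_ne_zero.mpr hj)

lemma core {d : ℕ} (w : Fin d → Fin d → ℂ) (β : ℂ) (hβ : ∀ k : ℕ, β ≠ -(k : ℂ))
    (n : Fin d → ℕ) (x : Fin d → ℂ) (v : Fin d → ℂ) (i : Fin d) (q : ℂ)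
    (hq : ∀ j, ∑ k, v k * w k j = if j = i then -q else 0) :
    ∑ A ∈ SS n, KK w β n A * ∑ k, v k * (rho A k *
      ((β + ∑ j, (((rho A - Pi.single k 1 : Fin d → ℕ) j : ℕ) : ℂ)) * phi (rho A - Pi.single k 1) x
      - ∑ l, w l i * phi (rho A - Pi.single k 1 + Pi.single l 1) x)) =
    q * (n i * ∑ A ∈ SS n, KK w β n A * phi (rho A) x) := by
  set R : (Fin d → Fin d → ℕ) → ℂ := fun B => (β + tot B) * phi (rho B) x -
    ∑ l, w l i * phi (rho B + Pi.single l 1) x with hR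
  set Q : Fin d → (Fin d → Fin d → ℕ) → ℂ := fun k A =>
    ((β + ∑ j, (((rho A - Pi.single k 1 : Fin d → ℕ) j : ℕ) : ℂ)) * phi (rho A - Pi.single k 1) x
      - ∑ l, w l i * phi (rho A - Pi.single k 1 + Pi.single l 1) x) with hQ
  have hQR : ∀ k j B, Q k (B + EE k j) = R B := by
    intro k j B
    have : rho (B + EE k j) - Pi.single k 1 = rho B := by
      rw [rho_add]; exact add_tsub_cancel_right _ _
    simp only [hQ, hR, this, tot_eq]
    push_cast
    rfl
  have s1 : ∑ A ∈ SS n, KK w β n A * ∑ k, v k * (rho A k * Q k A) =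
      ∑ k, ∑ j, v k * ∑ A ∈ SS n, (A k j : ℂ) * (KK w β n A * Q k A) := by
    have : ∀ A : Fin d → Fin d → ℕ, KK w β n A * ∑ k, v k * (rho A k * Q k A) =
        ∑ k, ∑ j, v k * ((A k j : ℂ) * (KK w β n A * Q k A)) := by
      intro A
      rw [Finset.mul_sum]
      refine Finset.sum_congr rfl fun k _ => ?_
      simp only [rho, Nat.cast_sum]
      rw [← Finset.mul_sum, ← Finset.sum_mul]
      ring
    simp_rw [this]
    rw [Finset.sum_comm]
    refine Finset.sum_congr rfl fun k _ => ?_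
    rw [Finset.sum_comm]
    simp_rw [Finset.mul_sum]
  rw [s1]
  have s2 : ∀ k j, ∑ A ∈ SS n, (A k j : ℂ) * (KK w β n A * Q k A) =
      ∑ B ∈ SS n, w k j * ((sig B j - n j) * (KK w β n B * R B / (β + tot B))) := by
    intro k j
    rw [reindex n (fun A => KK w β n A * Q k A)
      (fun A hA => by simp [KK_zero w β n A hA]) k j]
    refine Finset.sum_congr rfl fun B _ => ?_
    rw [hQR, ← mul_assoc, KK_add w β hβ]
    ring
  have s3 : ∑ k, ∑ j, v k * ∑ A ∈ SS n, (A k j : ℂ) * (KK w β n A * Q k A) =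
      -q * ∑ B ∈ SS n, ((sig B i - n i) * (KK w β n B * R B / (β + tot B))) := by
    have e : ∀ k j, v k * ∑ A ∈ SS n, (A k j : ℂ) * (KK w β n A * Q k A) =
        (v k * w k j) *
          ∑ B ∈ SS n, ((sig B j - n j) * (KK w β n B * R B / (β + tot B))) := by
      intro k j
      rw [s2, ← Finset.mul_sum, mul_assoc]
    simp_rw [e]
    rw [Finset.sum_comm]
    simp_rw [← Finset.sum_mul, hq]
    simp
  rw [s3]
  have s4 : ∀ B, ((sig B i - n i) * (KK w β n B * R B / (β + tot B))) =
      (sig B i - n i) * (KK w β n B * phi (rho B) x) -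
      ∑ l, ((B l i : ℂ) + 1) * (KK w β n (B + EE l i) * phi (rho (B + EE l i)) x) := by
    intro B
    have h2 : β + tot B ≠ 0 := fun h => hβ _ (eq_neg_of_add_eq_zero_left h)
    simp_rw [← mul_assoc ((B _ i : ℂ) + 1), KK_add w β hβ, rho_add, hR]
    have : ∑ l, w l i * (sig B i - n i) * KK w β n B / (β + tot B) *
        phi (rho B + Pi.single l 1) x = (sig B i - n i) * KK w β n B / (β + tot B) *
        ∑ l, w l i * phi (rho B + Pi.single l 1) x := by
      rw [Finset.mul_sum]
      exact Finset.sum_congr rfl fun l _ => by ring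
    rw [this]
    field_simp
  simp_rw [s4]
  rw [Finset.sum_sub_distrib]
  have s5 : ∑ B ∈ SS n, ∑ l, ((B l i : ℂ) + 1) *
      (KK w β n (B + EE l i) * phi (rho (B + EE l i)) x) =
      ∑ A ∈ SS n, (sig A i : ℂ) * (KK w β n A * phi (rho A) x) := by
    rw [Finset.sum_comm]
    have : ∀ l, ∑ B ∈ SS n, ((B l i : ℂ) + 1) *
      (KK w β n (B + EE l i) * phi (rho (B + EE l i)) x) =
      ∑ A ∈ SS n, (A l i : ℂ) * (KK w β n A * phi (rho A) x) := fun l =>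
      (reindex n (fun A => KK w β n A * phi (rho A) x)
        (fun A hA => by simp [KK_zero w β n A hA]) l i).symm
    simp_rw [this]
    rw [Finset.sum_comm]
    simp_rw [← Finset.sum_mul, sig, Nat.cast_sum]
  rw [s5]
  simp_rw [sub_mul, Finset.sum_sub_distrib, ← Finset.mul_sum]
  ring

end MeixAux

/-- Theorem 4.1, equation (4.2a): the difference equation in the variables `x`,
`L^{(i)} P_n(x) = n_i P_n(x)` with `L^{(i)}` the operator (4.1a). -/
theorem meixner_difference_eq_x (d : ℕ) (hd : 1 ≤ d) (c0 : ℂ) (c ct : Fin d → ℂ)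
    (U : Matrix (Fin (d + 1)) (Fin (d + 1)) ℂ) (hm : MeixnerMem d c0 c ct U)
    (β : ℂ) (hβ : ∀ k : ℕ, β ≠ -(k : ℂ)) (i : Fin d) (n : Fin d → ℕ)
    (x : Fin d → ℂ) :
    ct i / c0 *
        ((∑ k : Fin d, ∑ l ∈ Finset.univ.erase k,
            c k * U k.succ i.succ * U l.succ i.succ * x l *
              (meixnerP d U β n
                  (fun j => x j + (if j = k then 1 else 0) - (if j = l then 1 else 0)) -
                meixnerP d U β n x)) -
          (∑ l : Fin d, U l.succ i.succ * x l *
            (meixnerP d U β n (fun j => x j - (if j = l then 1 else 0)) -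
              meixnerP d U β n x)) -
          ∑ k : Fin d, c k * U k.succ i.succ * (β + ∑ j, x j) *
            (meixnerP d U β n (fun j => x j + (if j = k then 1 else 0)) -
              meixnerP d U β n x)) =
      (n i : ℂ) * meixnerP d U β n x := by
  obtain ⟨hct, hcu, hq⟩ := MeixAux.mem_rel hm i
  have hc0 : c0 ≠ 0 := hm.1
  have h1 := MeixAux.bracket_lin (MeixAux.SS n)
    (MeixAux.KK (fun i j => 1 - U i.succ j.succ) β n) (fun A => MeixAux.phi (MeixAux.rho A))
    x c (fun k => U k.succ i.succ) (β + ∑ j, x j) (meixnerP d U β n)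
    (MeixAux.meixnerP_eq d U β n)
  refine (congrArg (fun z => ct i / c0 * z) h1).trans ?_
  have h2 := fun A : Fin d → Fin d → ℕ =>
    MeixAux.bracket_phi (MeixAux.rho A) x c (fun k => U k.succ i.succ) β hcu
  have h3 := MeixAux.core (fun i j => 1 - U i.succ j.succ) β hβ n x
    (fun k => c k * U k.succ i.succ) i (c0 / ct i) hq
  have h4 := (Finset.sum_congr rfl fun A _ =>
    congrArg (fun z => MeixAux.KK (fun i j => 1 - U i.succ j.succ) β n A * z) (h2 A)).trans h3
  refine (congrArg (fun z => ct i / c0 * z) h4).trans ?_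
  rw [MeixAux.meixnerP_eq]
  beta_reduce
  field_simp
end

section
/- (Difference equation in the degree indices n.) Let d ≥ 1, let 𝔪 = (c₀, C, C̃, U) ∈ 𝔐_d, and let β be a complex number that is not a nonpositive integer. Then for every i ∈ {1,…,d}, every n ∈ ℕ₀^d, and every x ∈ ℂ^d, writing e_k for the k-th standard basis vector and P_m(x) = P_m(x; 𝔪, β): (c_i/c₀) [ Σ_{1≤k≠l≤d} c̃_k u_{i,k} u_{i,l} n_l (P_{n+e_k−e_l}(x) − P_n(x)) − Σ_{l=1}^d u_{i,l} n_l (P_{n−e_l}(x) − P_n(x)) − Σ_{k=1}^d c̃_k u_{i,k} (β+|n|) (P_{n+e_k}(x) − P_n(x)) ] = x_i P_n(x), where |n| = n₁+…+n_d and every term carrying the factor n_l is understood to vanish when n_l = 0 (so the backward shifts n−e_l and n+e_k−e_l are only evaluated when n_l ≥ 1). -/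
open Finset Matrix

namespace MeixnerAux

variable {d : ℕ}

lemma prod_upd {ι : Type*} [Fintype ι] [DecidableEq ι] (a : ι) (F G : ι → ℂ) (s c : ℂ)
    (h : ∀ b, b ≠ a → F b = G b) (ha : s * F a = G a * c) :
    s * ∏ b, F b = (∏ b, G b) * c := by
  rw [← Finset.mul_prod_erase univ F (mem_univ a), ← Finset.mul_prod_erase univ G (mem_univ a),
    Finset.prod_congr rfl (fun b hb => h b (Finset.ne_of_mem_erase hb)), ← mul_assoc, ha]
  ring

/-- product of Pochhammer symbols -/
noncomputable def poch (s : Fin d → ℕ) (y : Fin d → ℂ) : ℂ :=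
  ∏ j, (ascPochhammer ℂ (s j)).eval (y j)

/-- unit vector -/
def e (k : Fin d) : Fin d → ℕ := fun j => if j = k then 1 else 0

/-- unit matrix -/
def E (m k : Fin d) : Fin d → Fin d → ℕ := fun a b => if a = m ∧ b = k then 1 else 0

def col (A : Fin d → Fin d → ℕ) : Fin d → ℕ := fun j => ∑ i, A i j
def row (A : Fin d → Fin d → ℕ) : Fin d → ℕ := fun i => ∑ j, A i j
def tot (A : Fin d → Fin d → ℕ) : ℕ := ∑ i, ∑ j, A i j

lemma col_add (A : Fin d → Fin d → ℕ) (m k : Fin d) : col (A + E m k) = col A + e k := by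
  funext j
  simp only [col, E, e, Pi.add_apply, Finset.sum_add_distrib]
  by_cases h : j = k <;> simp [h]

lemma row_add (A : Fin d → Fin d → ℕ) (m k : Fin d) : row (A + E m k) = row A + e m := by
  funext j
  simp only [row, E, e, Pi.add_apply, Finset.sum_add_distrib]
  by_cases h : j = m <;> simp [h]

lemma tot_row (A : Fin d → Fin d → ℕ) : tot A = ∑ i, row A i := rfl
lemma tot_col (A : Fin d → Fin d → ℕ) : tot A = ∑ i, col A i := Finset.sum_comm

lemma tot_add (A : Fin d → Fin d → ℕ) (m k : Fin d) : tot (A + E m k) = tot A + 1 := by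
  rw [tot_row, row_add]
  simp [Finset.sum_add_distrib, e, tot_row]

lemma poch_add (s : Fin d → ℕ) (y : Fin d → ℂ) (k : Fin d) :
    poch (s + e k) y = poch s y * (y k + s k) := by
  have := prod_upd k (fun j => (ascPochhammer ℂ ((s + e k) j)).eval (y j))
    (fun j => (ascPochhammer ℂ (s j)).eval (y j)) 1 (y k + s k)
    (by intro b hb; simp [e, hb])
    (by simp [e, ascPochhammer_succ_eval])
  simpa [poch] using this

/-- the value at `-n` -/
noncomputable def f (s n : Fin d → ℕ) : ℂ := poch s (fun j => -(n j : ℂ))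

lemma f_zero (s n : Fin d → ℕ) (j : Fin d) (h : n j < s j) : f s n = 0 := by
  unfold f poch
  exact Finset.prod_eq_zero (mem_univ j) (ascPochhammer_eval_neg_coe_nat_of_lt h)

lemma f_add (s n : Fin d → ℕ) (k : Fin d) :
    f (s + e k) n = f s n * ((s k : ℂ) - n k) := by
  unfold f
  rw [poch_add]; ring

lemma asc_left (m : ℕ) (y : ℂ) :
    (ascPochhammer ℂ (m + 1)).eval y = y * (ascPochhammer ℂ m).eval (y + 1) := by
  rw [ascPochhammer_succ_left]; simp

lemma f_pred (s n : Fin d → ℕ) (l : Fin d) :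
    (n l : ℂ) * f s (n - e l) = ((n l : ℂ) - s l) * f s n := by
  have := prod_upd l (fun j => (ascPochhammer ℂ (s j)).eval (-((n - e l) j : ℕ) : ℂ))
    (fun j => (ascPochhammer ℂ (s j)).eval (-(n j : ℂ))) (n l) ((n l : ℂ) - s l)
    (by intro b hb; simp [e, hb])
    (by
      rcases hn : n l with _ | p
      · rcases hs : s l with _ | q
        · simp
        · simp [asc_left]
      · simp only [Pi.sub_apply, hn, e, if_true, Nat.add_sub_cancel]
        have h1 := asc_left (s l) (-((p + 1 : ℕ) : ℂ))
        rw [ascPochhammer_succ_eval] at h1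
        have h2 : (-((p + 1 : ℕ) : ℂ)) + 1 = -(p : ℂ) := by push_cast; ring
        rw [h2] at h1
        push_cast at h1 ⊢
        linear_combination h1)
  unfold f poch
  rw [this]; ring

lemma f_sub (s n : Fin d → ℕ) (k : Fin d) :
    (s k : ℂ) * f s n = (s k : ℂ) * f (s - e k) n * ((s k : ℂ) - 1 - n k) := by
  rcases Nat.eq_zero_or_pos (s k) with h | h
  · simp [h]
  · have hs : s = (s - e k) + e k := by
      funext j
      by_cases hj : j = k
      · subst hj; simp [e]; omega
      · simp [e, hj]
    have h1 := f_add (s - e k) n k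
    rw [← hs] at h1
    rw [h1]
    have : (((s - e k) k : ℕ) : ℂ) = (s k : ℂ) - 1 := by
      simp [e, Nat.cast_sub (show 1 ≤ s k from h)]
    rw [this]; ring

lemma f_succ (s n : Fin d → ℕ) (k : Fin d) :
    f s (n + e k) = f s n - (s k : ℂ) * f (s - e k) n := by
  unfold f poch
  rw [← Finset.mul_prod_erase univ _ (mem_univ k), ← Finset.mul_prod_erase univ _ (mem_univ k),
    ← Finset.mul_prod_erase univ (fun j => (ascPochhammer ℂ ((s - e k) j)).eval (-(n j : ℂ)))
      (mem_univ k)]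
  have h1 : ∀ b ∈ univ.erase k, (ascPochhammer ℂ (s b)).eval (-((n + e k) b : ℕ) : ℂ)
      = (ascPochhammer ℂ (s b)).eval (-(n b : ℂ)) := by
    intro b hb; simp [e, Finset.ne_of_mem_erase hb]
  have h2 : ∀ b ∈ univ.erase k, (ascPochhammer ℂ ((s - e k) b)).eval (-(n b : ℂ))
      = (ascPochhammer ℂ (s b)).eval (-(n b : ℂ)) := by
    intro b hb; simp [e, Finset.ne_of_mem_erase hb]
  rw [Finset.prod_congr rfl h1, Finset.prod_congr rfl h2]
  have h3 : (ascPochhammer ℂ (s k)).eval (-((n + e k) k : ℕ) : ℂ) =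
      (ascPochhammer ℂ (s k)).eval (-(n k : ℂ))
        - s k * (ascPochhammer ℂ ((s - e k) k)).eval (-(n k : ℂ)) := by
    simp only [Pi.add_apply, Pi.sub_apply, e, if_true]
    rcases s k with _ | q
    · simp
    · rw [asc_left, ascPochhammer_succ_eval]
      have : (-((n k + 1 : ℕ) : ℂ)) + 1 = -(n k : ℂ) := by push_cast; ring
      rw [this]
      simp only [Nat.add_sub_cancel]
      push_cast; ring
  rw [h3]; ring

/-- The bracket. -/
noncomputable def Br (a u : Fin d → ℂ) (β : ℂ) (n : Fin d → ℕ) (φ : (Fin d → ℕ) → ℂ) : ℂ :=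
  (∑ k : Fin d, ∑ l ∈ Finset.univ.erase k, a k * u l * (n l : ℂ) * (φ (n + e k - e l) - φ n)) -
    (∑ l : Fin d, u l * (n l : ℂ) * (φ (n - e l) - φ n)) -
    ∑ k : Fin d, a k * (β + ∑ j, (n j : ℂ)) * (φ (n + e k) - φ n)

/-- the reduced operator -/
noncomputable def Phi (u : Fin d → ℂ) (β : ℂ) (n : Fin d → ℕ) (t : Fin d → ℕ) : ℂ :=
  f t n * (β + ∑ l, (t l : ℂ) - ∑ l, (1 - u l) * ((t l : ℂ) - n l))

lemma Br_f (a u : Fin d → ℂ) (β : ℂ) (n s : Fin d → ℕ) (ha : ∑ k, a k = 1) :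
    Br a u β n (f s) = ∑ k, a k * ((s k : ℂ) * Phi u β n (s - e k)) := by
  have hX : ∀ k l, l ≠ k → (n l : ℂ) * f s (n + e k - e l) =
      ((n l : ℂ) - s l) * (f s n - (s k : ℂ) * f (s - e k) n) := by
    intro k l hl
    have := f_pred s (n + e k) l
    rw [f_succ] at this
    simpa [e, hl] using this
  have h1 : ∀ k, ∑ l ∈ Finset.univ.erase k, a k * u l * (n l : ℂ) * (f s (n + e k - e l) - f s n)
      = ∑ l, a k * u l * (-(s l : ℂ) * f s n - ((n l : ℂ) - s l) * ((s k : ℂ) * f (s - e k) n))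
        - a k * u k * ((s k : ℂ) * f (s - e k) n) := by
    intro k
    rw [← Finset.add_sum_erase univ (fun l => a k * u l *
      (-(s l : ℂ) * f s n - ((n l : ℂ) - s l) * ((s k : ℂ) * f (s - e k) n))) (mem_univ k)]
    rw [Finset.sum_congr rfl (g := fun l => a k * u l *
      (-(s l : ℂ) * f s n - ((n l : ℂ) - s l) * ((s k : ℂ) * f (s - e k) n)))]
    · linear_combination a k * u k * f_sub s n k
    · intro l hl
      linear_combination a k * u l * hX k l (Finset.ne_of_mem_erase hl)
  have h2 : ∑ l : Fin d, u l * (n l : ℂ) * (f s (n - e l) - f s n)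
      = ∑ l, u l * (-(s l : ℂ) * f s n) := by
    refine Finset.sum_congr rfl fun l _ => ?_
    linear_combination u l * f_pred s n l
  have hPhi : ∀ k, (s k : ℂ) * Phi u β n (s - e k) = (s k : ℂ) * f (s - e k) n *
      (β + ∑ j, (n j : ℂ) - u k + ∑ l, u l * ((s l : ℂ) - n l)) := by
    intro k
    rcases Nat.eq_zero_or_pos (s k) with h | h
    · simp [h]
    · have hc : ∀ l, (((s - e k) l : ℕ) : ℂ) = (s l : ℂ) - if l = k then 1 else 0 := by
        intro l
        by_cases hl : l = k
        · subst hl; simp [e, Nat.cast_sub (show 1 ≤ s l from h)]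
        · simp [e, hl]
      unfold Phi
      rw [mul_assoc]
      congr 2
      simp only [hc]
      have : ∑ l, (1 - u l) * ((s l : ℂ) - (if l = k then 1 else 0) - n l) =
          ∑ l, (s l : ℂ) - ∑ l, (n l : ℂ) - ∑ l, u l * ((s l : ℂ) - n l) -
            ∑ l, (1 - u l) * (if l = k then 1 else 0) := by
        simp only [← Finset.sum_sub_distrib]
        refine Finset.sum_congr rfl fun l _ => ?_
        ring
      rw [this]
      simp [Finset.sum_sub_distrib]
      ring
  unfold Br
  simp only [h1, h2, hPhi, f_succ]
  have h3 : ∀ k, ∑ l, a k * u l *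
      (-(s l : ℂ) * f s n - ((n l : ℂ) - s l) * ((s k : ℂ) * f (s - e k) n)) =
      a k * (∑ l, u l * (-(s l : ℂ) * f s n)) + a k * ((s k : ℂ) * f (s - e k) n) *
        ∑ l, u l * ((s l : ℂ) - n l) := by
    intro k
    rw [Finset.mul_sum, Finset.mul_sum, ← Finset.sum_add_distrib]
    refine Finset.sum_congr rfl fun l _ => ?_
    ring
  simp only [h3]
  generalize ∑ l, u l * (-(s l : ℂ) * f s n) = X
  generalize ∑ l, u l * ((s l : ℂ) - n l) = Y
  have h4 : X = ∑ k, a k * X := by rw [← Finset.sum_mul, ha, one_mul]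
  conv_lhs => enter [1, 2]; rw [h4]
  simp only [← Finset.sum_sub_distrib]
  refine Finset.sum_congr rfl fun l _ => ?_
  ring

/-- the coefficient -/
noncomputable def q (w : Fin d → Fin d → ℂ) (β : ℂ) (x : Fin d → ℂ) (A : Fin d → Fin d → ℕ) : ℂ :=
  poch (row A) (fun i => -x i) / (ascPochhammer ℂ (tot A)).eval β *
    ∏ i, ∏ j, w i j ^ A i j / (Nat.factorial (A i j) : ℂ)

lemma asc_ne (β : ℂ) (hβ : ∀ k : ℕ, β ≠ -(k : ℂ)) (m : ℕ) :
    (ascPochhammer ℂ m).eval β ≠ 0 := by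
  induction m with
  | zero => simp
  | succ m ih =>
    rw [ascPochhammer_succ_eval]
    refine mul_ne_zero ih fun h => hβ m (by linear_combination h)

lemma q_add (w : Fin d → Fin d → ℂ) (β : ℂ) (hβ : ∀ k : ℕ, β ≠ -(k : ℂ)) (x : Fin d → ℂ)
    (A : Fin d → Fin d → ℕ) (m k : Fin d) :
    ((A m k : ℂ) + 1) * q w β x (A + E m k) =
      q w β x A * (w m k * (row A m - x m) / (β + tot A)) := by
  have h1 := prod_upd (m, k)
    (fun p : Fin d × Fin d => w p.1 p.2 ^ ((A + E m k) p.1 p.2) /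
      (Nat.factorial ((A + E m k) p.1 p.2) : ℂ))
    (fun p : Fin d × Fin d => w p.1 p.2 ^ (A p.1 p.2) / (Nat.factorial (A p.1 p.2) : ℂ))
    ((A m k : ℂ) + 1) (w m k)
    (by
      rintro ⟨a, b⟩ hb
      have : ¬ (a = m ∧ b = k) := fun h => hb (by rw [h.1, h.2])
      simp [E, this])
    (by
      simp only [Pi.add_apply, E, and_self, if_true, Nat.factorial_succ, pow_succ]
      have : ((A m k : ℂ) + 1) ≠ 0 := by exact_mod_cast Nat.succ_ne_zero (A m k)
      have h' : ((A m k).factorial : ℂ) ≠ 0 := by exact_mod_cast Nat.factorial_ne_zero _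
      push_cast
      field_simp)
  rw [Fintype.prod_prod_type, Fintype.prod_prod_type] at h1
  simp only at h1
  unfold q
  rw [row_add, poch_add, tot_add, ascPochhammer_succ_eval]
  have hb : β + (tot A : ℂ) ≠ 0 := fun h => hβ (tot A) (by linear_combination h)
  have hc := asc_ne β hβ (tot A)
  calc _ = poch (row A) (fun i => -x i) * (-x m + row A m) /
        ((ascPochhammer ℂ (tot A)).eval β * (β + tot A)) * (((A m k : ℂ) + 1) *
        ∏ i, ∏ j, w i j ^ ((A + E m k) i j) / (Nat.factorial ((A + E m k) i j) : ℂ)) := by ring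
    _ = _ := by
      rw [h1]
      field_simp
      ring

lemma summ (r : (Fin d → Fin d → ℕ) → ℂ) (n : Fin d → ℕ) :
    Summable (fun A => r A * f (col A) n) := by
  apply summable_of_ne_finset_zero
    (s := Fintype.piFinset fun _ : Fin d => Fintype.piFinset fun j : Fin d =>
      Finset.range (n j + 1))
  intro A hA
  simp only [Fintype.mem_piFinset, Finset.mem_range, not_forall, not_lt] at hA
  obtain ⟨i, j, h⟩ := hA
  have : A i j ≤ col A j := Finset.single_le_sum (f := fun i => A i j) (fun _ _ => Nat.zero_le _)
    (mem_univ i)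
  rw [f_zero (col A) n j (by omega), mul_zero]

lemma hasSum_shift (m k : Fin d) (F : (Fin d → Fin d → ℕ) → ℂ) (S : ℂ) :
    HasSum (fun A => F (A + E m k)) S ↔ (HasSum (fun A => if A m k = 0 then 0 else F A) S) := by
  have hinj : Function.Injective (fun A : Fin d → Fin d → ℕ => A + E m k) :=
    fun _ _ h => add_right_cancel h
  rw [← hinj.hasSum_iff (f := fun A => if A m k = 0 then 0 else F A)]
  · have : ((fun A => if A m k = 0 then 0 else F A) ∘
      (fun A : Fin d → Fin d → ℕ => A + E m k)) = fun A => F (A + E m k) := by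
      funext A; simp [E]
    rw [this]
  · intro A hA
    by_cases h : A m k = 0
    · simp [h]
    · exfalso; apply hA
      refine ⟨A - E m k, ?_⟩
      funext a b
      by_cases hab : a = m ∧ b = k
      · obtain ⟨rfl, rfl⟩ := hab; simp [E]; omega
      · simp [E, hab]

lemma hasSum_shift' (m k : Fin d) (F : (Fin d → Fin d → ℕ) → ℂ) (S : ℂ) :
    HasSum (fun A => ((A m k : ℂ) + 1) * F (A + E m k)) S ↔
      (HasSum (fun A => (A m k : ℂ) * F A) S) := by
  have := hasSum_shift m k (fun A => (A m k : ℂ) * F A) S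
  simp only [Pi.add_apply, E, and_self, if_true, Nat.cast_add, Nat.cast_one] at this
  refine this.trans ?_
  have h : (fun A : Fin d → Fin d → ℕ => if A m k = 0 then 0 else (A m k : ℂ) * F A) =
      fun A => (A m k : ℂ) * F A := by
    funext A
    by_cases h : A m k = 0 <;> simp [h]
  rw [h]

lemma hasSum_P (U : Matrix (Fin (d + 1)) (Fin (d + 1)) ℂ)
    (β : ℂ) (n : Fin d → ℕ) (x : Fin d → ℂ) :
    HasSum (fun A => q (fun i j => 1 - U i.succ j.succ) β x A * f (col A) n)
      (meixnerP d U β n x) := by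
  unfold meixnerP
  have hterm : ∀ A : Fin d → Fin d → ℕ, (∏ j, (ascPochhammer ℂ (∑ i, A i j)).eval (-(n j : ℂ))) *
        (∏ i, (ascPochhammer ℂ (∑ j, A i j)).eval (-(x i))) /
        (ascPochhammer ℂ (∑ i, ∑ j, A i j)).eval β *
      ∏ i, ∏ j, (1 - U i.succ j.succ) ^ (A i j) / (Nat.factorial (A i j) : ℂ) =
      q (fun i j => 1 - U i.succ j.succ) β x A * f (col A) n := by
    intro A
    unfold q f poch col row tot
    ring
  simp only [hterm]
  apply hasSum_sum_of_ne_finset_zero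
  intro A hA
  simp only [Finset.mem_filter, Fintype.mem_piFinset, Finset.mem_range, not_and_or, not_forall,
    not_lt, not_le] at hA
  have : ∃ j, n j < col A j := by
    rcases hA with ⟨i, j, h⟩ | ⟨j, h⟩
    · have : A i j ≤ col A j := Finset.single_le_sum (f := fun i => A i j)
        (fun _ _ => Nat.zero_le _) (mem_univ i)
      exact ⟨j, by omega⟩
    · exact ⟨j, h⟩
  obtain ⟨j, h⟩ := this
  rw [f_zero _ _ j h, mul_zero]

lemma hasSum_Br (a u : Fin d → ℂ) (β : ℂ) (n : Fin d → ℕ)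
    (Q : (Fin d → Fin d → ℕ) → ℂ) (P : (Fin d → ℕ) → ℂ)
    (h : ∀ n, HasSum (fun A => Q A * f (col A) n) (P n)) :
    HasSum (fun A => Q A * Br a u β n (f (col A))) (Br a u β n P) := by
  have : HasSum (fun A => Br a u β n (fun n => Q A * f (col A) n)) (Br a u β n P) := by
    unfold Br
    refine ((hasSum_sum fun k _ => hasSum_sum fun l _ => ?_).sub
      (hasSum_sum fun l _ => ?_)).sub (hasSum_sum fun k _ => ?_)
    all_goals exact ((h _).sub (h _)).mul_left _
  convert this using 2 with A
  unfold Br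
  simp only [mul_sub, Finset.mul_sum]
  simp only [mul_left_comm (Q A)]
  

lemma main (w : Fin d → Fin d → ℂ) (a : Fin d → ℂ) (β : ℂ) (hβ : ∀ k : ℕ, β ≠ -(k : ℂ))
    (x : Fin d → ℂ) (n : Fin d → ℕ) (P : (Fin d → ℕ) → ℂ) (i : Fin d) (g : ℂ)
    (h : ∀ n, HasSum (fun A => q w β x A * f (col A) n) (P n))
    (ha : ∑ k, a k = 1) (haw : ∀ m, ∑ k, a k * w m k = if m = i then -g else 0) :
    Br a (fun l => 1 - w i l) β n P = g * (x i * P n) := by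
  set u : Fin d → ℂ := fun l => 1 - w i l with hu
  have H := hasSum_Br a u β n _ P h
  simp only [Br_f a u β n _ ha] at H
  -- per (m,k) sums
  have hB : ∀ B : Fin d → Fin d → ℕ, β + (tot B : ℂ) ≠ 0 :=
    fun B h => hβ (tot B) (by linear_combination h)
  have S1 : ∀ m k, ∃ S, HasSum (fun B => q w β x B * (w m k * (row B m - x m) / (β + tot B)) *
      Phi u β n (col B)) S := by
    intro m k
    have := summ (fun B => q w β x B * (w m k * (row B m - x m) / (β + tot B)) *
      (β + ∑ l, (col B l : ℂ) - ∑ l, (1 - u l) * ((col B l : ℂ) - n l))) n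
    refine ⟨_, this.hasSum.congr_fun ?_⟩
    intro B
    unfold Phi
    ring
  choose S hS using S1
  have hS' : ∀ m k, HasSum (fun A => (A m k : ℂ) *
      (q w β x A * Phi u β n (col A - e k))) (S m k) := by
    intro m k
    rw [← hasSum_shift']
    refine (hS m k).congr_fun ?_
    intro B
    rw [← mul_assoc, q_add w β hβ, col_add, add_tsub_cancel_right]
  have H2 : HasSum (fun A => q w β x A * ∑ k, a k * ((col A k : ℂ) * Phi u β n (col A - e k)))
      (∑ k, ∑ m, a k * S m k) := by
    refine (hasSum_sum fun k _ => hasSum_sum fun m _ => (hS' m k).mul_left (a k)).congr_fun ?_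
    intro A
    rw [Finset.mul_sum]
    refine Finset.sum_congr rfl fun k _ => ?_
    simp only [col, Nat.cast_sum, Finset.sum_mul, Finset.mul_sum]
    refine Finset.sum_congr rfl fun m _ => ?_
    ring
  have e1 := H.unique H2
  have H3 : HasSum (fun B => g * (q w β x B * ((x i - row B i) / (β + tot B)) *
      Phi u β n (col B))) (∑ k, ∑ m, a k * S m k) := by
    refine (hasSum_sum fun k _ => hasSum_sum fun m _ => (hS m k).mul_left (a k)).congr_fun ?_
    intro B
    rw [Finset.sum_comm]
    have : ∀ m, ∑ k, a k * (q w β x B * (w m k * (row B m - x m) / (β + tot B)) *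
        Phi u β n (col B)) = (if m = i then -g else 0) *
        (q w β x B * ((row B m - x m) / (β + tot B)) * Phi u β n (col B)) := by
      intro m
      rw [← haw, Finset.sum_mul]
      refine Finset.sum_congr rfl fun k _ => ?_
      ring
    simp only [this, ite_mul, zero_mul, Finset.sum_ite_eq', Finset.mem_univ, if_true]
    ring
  have T : ∀ l, HasSum (fun A => (A i l : ℂ) * (q w β x A * f (col A) n))
      (∑' A, (A i l : ℂ) * (q w β x A * f (col A) n)) := by
    intro l
    refine Summable.hasSum ?_
    refine (summ (fun A => (A i l : ℂ) * q w β x A) n).congr ?_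
    intro A; ring
  have T' := fun l => (hasSum_shift' i l _ _).2 (T l)
  have H4 := (((h n).mul_left (x i)).sub (hasSum_sum (s := univ) fun l _ => T l)).add
    (hasSum_sum (s := univ) fun l _ => T' l)
  rw [sub_add_cancel] at H4
  have H5 := H4.mul_left g
  rw [e1]
  refine H3.unique (H5.congr_fun ?_)
  intro B
  have : ∀ l, ((B i l : ℂ) + 1) * (q w β x (B + E i l) * f (col (B + E i l)) n) =
      q w β x B * f (col B) n * ((row B i - x i) / (β + tot B)) *
        (w i l * ((col B l : ℂ) - n l)) := by
    intro l
    rw [← mul_assoc, q_add w β hβ, col_add, f_add]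
    ring
  simp only [this]
  rw [← Finset.mul_sum, ← Finset.sum_mul]
  have hr : ∑ l, (B i l : ℂ) = row B i := by simp [row]
  have ht : ∑ l, (col B l : ℂ) = tot B := by rw [tot_col]; simp
  rw [hr]
  unfold Phi
  rw [ht]
  simp only [hu, sub_sub_cancel]
  have := hB B
  field_simp
  ring

lemma rel (c0 : ℂ) (c ct : Fin d → ℂ)
    (U : Matrix (Fin (d + 1)) (Fin (d + 1)) ℂ) (hm : MeixnerMem d c0 c ct U) (i : Fin d) :
    c i ≠ 0 ∧ ∑ k : Fin d, ct k * U i.succ k.succ = 1 ∧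
    ∀ m : Fin d, ∑ k : Fin d, ct k * U i.succ k.succ * (1 - U m.succ k.succ) =
      if m = i then -(c0 / c i) else 0 := by
  obtain ⟨h0, hr, hc, h⟩ := hm
  set C := Matrix.diagonal (Fin.cons (1 : ℂ) (fun k => -c k) : Fin (d+1) → ℂ) with hC
  set C' := Matrix.diagonal (Fin.cons (1 : ℂ) (fun k => -ct k) : Fin (d+1) → ℂ) with hC'
  have h1 : (c0⁻¹ • (Uᵀ * C)) * (U * C') = 1 := by
    rw [Matrix.smul_mul, ← Matrix.mul_assoc, h, smul_smul, inv_mul_cancel₀ h0, one_smul]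
  rw [mul_eq_one_comm, Matrix.mul_smul] at h1
  have h2 : U * C' * (Uᵀ * C) = c0 • (1 : Matrix _ _ ℂ) := by
    rw [← h1, smul_smul, mul_inv_cancel₀ h0, one_smul]
  have key : ∀ r s, (∑ k, U r k * (Fin.cons (1 : ℂ) (fun k => -ct k) : Fin (d+1) → ℂ) k * U s k) *
      (Fin.cons (1 : ℂ) (fun k => -c k) : Fin (d+1) → ℂ) s = if r = s then c0 else 0 := by
    intro r s
    have := congrFun (congrFun h2 r) s
    rw [← Matrix.mul_assoc, hC, Matrix.mul_diagonal, Matrix.mul_apply] at this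
    simp only [hC', Matrix.mul_diagonal, Matrix.transpose_apply, Matrix.smul_apply,
      Matrix.one_apply, smul_eq_mul, mul_ite, mul_one, mul_zero] at this
    exact this
  have k0 := key i.succ 0
  simp only [Fin.sum_univ_succ, Fin.cons_zero, Fin.cons_succ, hr, hc, mul_one, one_mul,
    Fin.succ_ne_zero, if_false] at k0
  have hs1 : ∑ k : Fin d, ct k * U i.succ k.succ = 1 := by
    have : ∑ k : Fin d, U i.succ k.succ * -ct k = - ∑ k : Fin d, ct k * U i.succ k.succ := by
      rw [← Finset.sum_neg_distrib]
      exact Finset.sum_congr rfl fun k _ => by ring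
    rw [this] at k0
    linear_combination -k0
  have km : ∀ m : Fin d, (1 - ∑ k : Fin d, ct k * U i.succ k.succ * U m.succ k.succ) * (-c m) =
      if i = m then c0 else 0 := by
    intro m
    have := key i.succ m.succ
    simp only [Fin.sum_univ_succ, Fin.cons_zero, Fin.cons_succ, hc, mul_one,
      Fin.succ_inj] at this
    rw [← this, sub_eq_add_neg, ← Finset.sum_neg_distrib]
    congr 2
    exact Finset.sum_congr rfl fun k _ => by ring
  have hcm : ∀ m : Fin d, c m ≠ 0 := by
    intro m hm0
    have := key m.succ m.succ
    simp [hm0] at this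
    exact h0 this.symm
  refine ⟨hcm i, hs1, fun m => ?_⟩
  have e2 : ∑ k : Fin d, ct k * U i.succ k.succ * (1 - U m.succ k.succ) =
      1 - ∑ k : Fin d, ct k * U i.succ k.succ * U m.succ k.succ := by
    simp only [mul_sub, mul_one, Finset.sum_sub_distrib, hs1]
  rw [e2]
  have hk := km m
  by_cases him : m = i
  · subst him
    simp only [if_true] at hk ⊢
    have := hcm m
    generalize (∑ k : Fin d, ct k * U m.succ k.succ * U m.succ k.succ) = Z at hk ⊢
    field_simp
    linear_combination -hk
  · rw [if_neg (Ne.symm him)] at hk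
    rw [if_neg him]
    exact (mul_eq_zero.1 hk).resolve_right (neg_ne_zero.2 (hcm m))

end MeixnerAux

/-- Theorem 4.1, equation (4.2b): the difference equation in the degree indices `n`,
`𝓛^{(i)} P_n(x) = x_i P_n(x)` with `𝓛^{(i)}` the operator (4.1b).  (Terms carrying
the factor `n_l` vanish when `n_l = 0`, so the truncated subtraction `n_l - 1` in `ℕ`
is harmless there.) -/
theorem meixner_difference_eq_n (d : ℕ) (hd : 1 ≤ d) (c0 : ℂ) (c ct : Fin d → ℂ)
    (U : Matrix (Fin (d + 1)) (Fin (d + 1)) ℂ) (hm : MeixnerMem d c0 c ct U)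
    (β : ℂ) (hβ : ∀ k : ℕ, β ≠ -(k : ℂ)) (i : Fin d) (n : Fin d → ℕ)
    (x : Fin d → ℂ) :
    c i / c0 *
        ((∑ k : Fin d, ∑ l ∈ Finset.univ.erase k,
            ct k * U i.succ k.succ * U i.succ l.succ * (n l : ℂ) *
              (meixnerP d U β
                  (fun j => n j + (if j = k then 1 else 0) - (if j = l then 1 else 0)) x -
                meixnerP d U β n x)) -
          (∑ l : Fin d, U i.succ l.succ * (n l : ℂ) *
            (meixnerP d U β (fun j => n j - (if j = l then 1 else 0)) x -
              meixnerP d U β n x)) -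
          ∑ k : Fin d, ct k * U i.succ k.succ * (β + ∑ j, (n j : ℂ)) *
            (meixnerP d U β (fun j => n j + (if j = k then 1 else 0)) x -
              meixnerP d U β n x)) =
      x i * meixnerP d U β n x := by
  obtain ⟨hci, h1, h2⟩ := MeixnerAux.rel c0 c ct U hm i
  have h0 := hm.1
  have key := MeixnerAux.main (fun i j => 1 - U i.succ j.succ) (fun k => ct k * U i.succ k.succ) β hβ
    x n (fun n => meixnerP d U β n x) i (c0 / c i)
    (fun n => MeixnerAux.hasSum_P U β n x) h1 h2
  simp only [sub_sub_cancel] at key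
  have key2 : c i / c0 * (c0 / c i * (x i * meixnerP d U β n x)) = x i * meixnerP d U β n x := by
    field_simp
  rw [← key] at key2
  exact key2
end

section
/- (Commutativity of the difference operators in x.) Let d ≥ 1, let 𝔪 = (c₀, C, C̃, U) ∈ 𝔐_d with all c_j, c̃_j real and positive (j = 1,…,d), all u_{i,j} real, and c₁ + ⋯ + c_d < 1, and let β be a real number with β > 0. For i ∈ {1,…,d} define the operator L^{(i)} acting on functions f : ℂ^d → ℂ by (L^{(i)}f)(x) = (c̃_i/c₀) [ Σ_{1≤k≠l≤d} c_k u_{k,i} u_{l,i} x_l (f(x+e_k−e_l) − f(x)) − Σ_{l=1}^d u_{l,i} x_l (f(x−e_l) − f(x)) − Σ_{k=1}^d c_k u_{k,i} (β+|x|) (f(x+e_k) − f(x)) ], where e_k is the k-th standard basis vector and |x| = x₁+…+x_d. Then for all i, i' ∈ {1,…,d} and every polynomial function p : ℂ^d → ℂ, L^{(i)}(L^{(i')}p) = L^{(i')}(L^{(i)}p) as functions on ℂ^d. -/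
open Finset Matrix

/-- The difference operator `L^{(i)}` of (4.1a), acting on functions of `x ∈ ℂ^d`. -/
noncomputable def meixnerLx (d : ℕ) (c0 : ℂ) (c ct : Fin d → ℂ)
    (U : Matrix (Fin (d + 1)) (Fin (d + 1)) ℂ) (β : ℂ) (i : Fin d)
    (f : (Fin d → ℂ) → ℂ) : (Fin d → ℂ) → ℂ := fun x =>
  ct i / c0 *
    ((∑ k : Fin d, ∑ l ∈ Finset.univ.erase k,
        c k * U k.succ i.succ * U l.succ i.succ * x l *
          (f (fun j => x j + (if j = k then 1 else 0) - (if j = l then 1 else 0)) - f x)) -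
      (∑ l : Fin d, U l.succ i.succ * x l *
        (f (fun j => x j - (if j = l then 1 else 0)) - f x)) -
      ∑ k : Fin d, c k * U k.succ i.succ * (β + ∑ j, x j) *
        (f (fun j => x j + (if j = k then 1 else 0)) - f x))

/-- The extended variables: `x_0 = -β - |x|`. -/
noncomputable def mxX (d : ℕ) (β : ℂ) (x : Fin d → ℂ) : Fin (d + 1) → ℂ :=
  Fin.cons (-β - ∑ j, x j) x

/-- The shift `x + e_k - e_l`, with `e_0 = 0`. -/
noncomputable def mxSh (d : ℕ) (k l : Fin (d + 1)) (x : Fin d → ℂ) : Fin d → ℂ :=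
  fun j => x j + (if j.succ = k then 1 else 0) - (if j.succ = l then 1 else 0)

/-- The rank one element of `gl_{d+1}` acting on functions. -/
noncomputable def mxS (d : ℕ) (β : ℂ) (a v : Fin (d + 1) → ℂ)
    (f : (Fin d → ℂ) → ℂ) : (Fin d → ℂ) → ℂ := fun x =>
  ∑ k, ∑ l, a k * v k * v l * mxX d β x l * f (mxSh d k l x)

lemma mxsum (d : ℕ) (k : Fin (d + 1)) :
    ∑ j : Fin d, (if j.succ = k then (1 : ℂ) else 0) = 1 - if 0 = k then 1 else 0 := by
  have h : ∑ j : Fin (d + 1), (if j = k then (1 : ℂ) else 0) = 1 := by simp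
  rw [Fin.sum_univ_succ] at h
  linear_combination h

lemma mxX_sh (d : ℕ) (β : ℂ) (x : Fin d → ℂ) (k l n : Fin (d + 1)) :
    mxX d β (mxSh d k l x) n
      = mxX d β x n + (if n = k then 1 else 0) - (if n = l then 1 else 0) := by
  refine Fin.cases ?_ (fun j => ?_) n
  · simp only [mxX, mxSh, Fin.cons_zero, sum_sub_distrib, sum_add_distrib, mxsum]
    ring
  · simp only [mxX, mxSh, Fin.cons_succ]

lemma mxSS (d : ℕ) (β : ℂ) (a v w : Fin (d + 1) → ℂ) (h : ∑ k, a k * v k * w k = 0)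
    (f : (Fin d → ℂ) → ℂ) (x : Fin d → ℂ) :
    mxS d β a v (mxS d β a w f) x
      = ∑ k, ∑ l, ∑ m, ∑ n, a k * v k * v l * (a m * w m * w n) *
          (mxX d β x l * mxX d β x n - (if n = l then mxX d β x l else 0)) *
          f (mxSh d m n (mxSh d k l x)) := by
  have key : ∀ k l m n, a k * v k * v l * mxX d β x l *
      (a m * w m * w n * mxX d β (mxSh d k l x) n * f (mxSh d m n (mxSh d k l x)))
      = a k * v k * v l * (a m * w m * w n) *
          (mxX d β x l * mxX d β x n - (if n = l then mxX d β x l else 0)) *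
          f (mxSh d m n (mxSh d k l x)) +
        (if n = k then (a k * v k * w k) * (v l * a m * w m * mxX d β x l *
          f (mxSh d m l x)) else 0) := by
    intro k l m n
    rw [mxX_sh]
    by_cases hk : n = k
    · subst hk
      have : mxSh d m n (mxSh d n l x) = mxSh d m l x := by
        funext j; simp only [mxSh]; ring
      rw [this]
      split_ifs <;> ring
    · rw [if_neg hk, if_neg hk]
      split_ifs <;> ring
  simp only [mxS, mul_sum, key, sum_add_distrib]
  rw [add_eq_left]
  simp only [sum_ite_eq', mem_univ, if_true]
  rw [sum_comm]
  refine sum_eq_zero fun l _ => ?_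
  rw [sum_comm]
  refine sum_eq_zero fun m _ => ?_
  rw [← sum_mul, h, zero_mul]

lemma mxS_comm (d : ℕ) (β : ℂ) (a v w : Fin (d + 1) → ℂ) (h : ∑ k, a k * v k * w k = 0)
    (f : (Fin d → ℂ) → ℂ) (x : Fin d → ℂ) :
    mxS d β a v (mxS d β a w f) x = mxS d β a w (mxS d β a v f) x := by
  have h' : ∑ k, a k * w k * v k = 0 := by
    rw [← h]; exact sum_congr rfl fun k _ => by ring
  rw [mxSS d β a v w h, mxSS d β a w v h']
  have e : ∀ F : Fin (d+1) → Fin (d+1) → Fin (d+1) → Fin (d+1) → ℂ,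
      ∑ k, ∑ l, ∑ m, ∑ n, F k l m n = ∑ k, ∑ l, ∑ m, ∑ n, F m n k l := by
    intro F
    have := sum_comm (s := (univ : Finset (Fin (d+1) × Fin (d+1))))
      (t := (univ : Finset (Fin (d+1) × Fin (d+1)))) (f := fun p q => F p.1 p.2 q.1 q.2)
    simpa only [Fintype.sum_prod_type] using this
  rw [e]
  refine sum_congr rfl fun k _ => sum_congr rfl fun l _ => sum_congr rfl fun m _ =>
    sum_congr rfl fun n _ => ?_
  have : mxSh d k l (mxSh d m n x) = mxSh d m n (mxSh d k l x) := by
    funext j; simp only [mxSh]; ring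
  rw [this]
  by_cases hn : n = l
  · subst hn; ring
  · rw [if_neg hn, if_neg (Ne.symm hn)]; ring

lemma mxorth (d : ℕ) (c0 : ℂ) (c ct : Fin d → ℂ)
    (U : Matrix (Fin (d + 1)) (Fin (d + 1)) ℂ) (hm : MeixnerMem d c0 c ct U)
    (hct : ∀ j, ct j ≠ 0) (i j : Fin (d + 1)) (hij : i ≠ j) :
    ∑ k, (Fin.cons (1 : ℂ) (fun k => -c k) : Fin (d + 1) → ℂ) k * U k i * U k j = 0 := by
  have h := congrFun (congrFun hm.2.2.2 i) j
  rw [Matrix.mul_diagonal, Matrix.mul_apply] at h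
  simp only [Matrix.mul_diagonal, Matrix.transpose_apply, Matrix.smul_apply,
    Matrix.one_apply_ne hij, smul_zero] at h
  have hne : (Fin.cons (1 : ℂ) (fun k => -ct k) : Fin (d + 1) → ℂ) j ≠ 0 := by
    refine Fin.cases ?_ (fun j => ?_) j
    · simp
    · simpa using hct j
  rw [← (mul_eq_zero.mp h).resolve_right hne]
  exact sum_congr rfl fun k _ => by ring

lemma mxL_eq (d : ℕ) (c0 : ℂ) (c ct : Fin d → ℂ)
    (U : Matrix (Fin (d + 1)) (Fin (d + 1)) ℂ) (hm : MeixnerMem d c0 c ct U)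
    (hct : ∀ j, ct j ≠ 0) (β : ℂ) (i : Fin d) (f : (Fin d → ℂ) → ℂ) :
    meixnerLx d c0 c ct U β i f = fun x => -(ct i / c0) *
      mxS d β (Fin.cons (1 : ℂ) (fun k => -c k)) (fun k => U k i.succ) f x := by
  funext x
  set a : Fin (d + 1) → ℂ := Fin.cons (1 : ℂ) (fun k => -c k) with ha
  have h0 : ∑ k, a k * U k i.succ = 0 := by
    have := mxorth d c0 c ct U hm hct i.succ 0 (Fin.succ_ne_zero i)
    simpa [hm.2.2.1] using this
  have h1 : mxS d β a (fun k => U k i.succ) f x =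
      ∑ k, ∑ l, a k * U k i.succ * U l i.succ * mxX d β x l * (f (mxSh d k l x) - f x) := by
    have : ∑ k, ∑ l, a k * U k i.succ * U l i.succ * mxX d β x l * f x = 0 := by
      have e : ∀ k, ∑ l, a k * U k i.succ * U l i.succ * mxX d β x l * f x
          = (a k * U k i.succ) * ∑ l, U l i.succ * mxX d β x l * f x := by
        intro k; rw [mul_sum]; exact sum_congr rfl fun l _ => by ring
      simp only [e]
      rw [← sum_mul, h0, zero_mul]
    simp only [mul_sub, sum_sub_distrib, this, sub_zero, mxS]
  rw [h1]
  simp only [meixnerLx]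
  rw [neg_mul, ← mul_neg]
  congr 1
  have hd0 : ∀ k, mxSh d k k x = x := by
    intro k; funext j; simp [mxSh]
  have s1 : ∀ k : Fin d, mxSh d k.succ 0 x = fun j => x j + (if j = k then 1 else 0) := by
    intro k; funext j; simp [mxSh]
  have s2 : ∀ k : Fin d, mxSh d 0 k.succ x = fun j => x j - (if j = k then 1 else 0) := by
    intro k; funext j; simp [mxSh]
  have s3 : ∀ k l : Fin d, mxSh d k.succ l.succ x =
      fun j => x j + (if j = k then 1 else 0) - (if j = l then 1 else 0) := by
    intro k l; funext j; simp [mxSh]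
  have hE : ∀ k : Fin d, ∑ l ∈ Finset.univ.erase k,
        c k * U k.succ i.succ * U l.succ i.succ * x l *
          (f (fun j => x j + (if j = k then 1 else 0) - (if j = l then 1 else 0)) - f x)
      = ∑ l, c k * U k.succ i.succ * U l.succ i.succ * x l *
          (f (fun j => x j + (if j = k then 1 else 0) - (if j = l then 1 else 0)) - f x) := by
    intro k
    apply sum_erase
    simp
  simp only [hE]
  simp only [Fin.sum_univ_succ, hd0, s1, s2, s3, sum_add_distrib, ha, mxX, Fin.cons_zero,
    Fin.cons_succ, hm.2.1, sub_self, mul_zero, zero_add, one_mul, mul_one, neg_mul,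
    sum_neg_distrib]
  have e3 : ∀ k, c k * U k.succ i.succ * (β + ∑ j, x j) *
        (f (fun j => x j + (if j = k then 1 else 0)) - f x)
      = -(c k * U k.succ i.succ * (-β - ∑ j, x j) *
        (f (fun j => x j + (if j = k then 1 else 0)) - f x)) := by
    intro k; ring
  simp only [e3, sum_neg_distrib]
  ring

lemma mxS_smul (d : ℕ) (β : ℂ) (a v : Fin (d + 1) → ℂ) (t : ℂ)
    (f : (Fin d → ℂ) → ℂ) (x : Fin d → ℂ) :
    mxS d β a v (fun y => t * f y) x = t * mxS d β a v f x := by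
  simp only [mxS, mul_sum]
  exact sum_congr rfl fun k _ => sum_congr rfl fun l _ => by ring

/-- Commutativity of the difference operators `L^{(i)}` acting on the variables:
for real positive data and `β > 0`, `L^{(i)} L^{(i')} p = L^{(i')} L^{(i)} p` for
every polynomial function `p` on `ℂ^d`. -/
theorem meixnerLx_commute (d : ℕ) (hd : 1 ≤ d) (c0 : ℂ) (c ct : Fin d → ℂ)
    (U : Matrix (Fin (d + 1)) (Fin (d + 1)) ℂ) (hm : MeixnerMem d c0 c ct U)
    (hc : ∀ j, ∃ r : ℝ, 0 < r ∧ c j = (r : ℂ))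
    (hct : ∀ j, ∃ r : ℝ, 0 < r ∧ ct j = (r : ℂ))
    (hU : ∀ i j, ∃ r : ℝ, U i j = (r : ℂ))
    (hsum : ∑ j, (c j).re < 1)
    (β : ℝ) (hβ : 0 < β) (i i' : Fin d) (p : MvPolynomial (Fin d) ℂ) :
    meixnerLx d c0 c ct U (β : ℂ) i
        (meixnerLx d c0 c ct U (β : ℂ) i' fun x => MvPolynomial.eval x p) =
      meixnerLx d c0 c ct U (β : ℂ) i'
        (meixnerLx d c0 c ct U (β : ℂ) i fun x => MvPolynomial.eval x p) := by
  by_cases hii : i = i'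
  · rw [hii]
  have hct' : ∀ j, ct j ≠ 0 := by
    intro j
    obtain ⟨r, hr, h⟩ := hct j
    rw [h]
    exact_mod_cast hr.ne'
  simp only [mxL_eq d c0 c ct U hm hct']
  funext x
  rw [mxS_smul, mxS_smul, mxS_comm]
  · ring
  · exact mxorth d c0 c ct U hm hct' i.succ i'.succ (fun h => hii (Fin.succ_injective _ h))
end

section
/- (Example 5.2: membership in 𝔐_d.) Let d ≥ 1 and let q be a complex number with q ∉ {0,1}. Define c_k = c̃_k = (1−q) q^{k−1} for k = 1,…,d, and define the (d+1)×(d+1) matrix U = (u_{i,j})_{0≤i,j≤d} by: u_{i,j} = 1 when i+j ≤ d, u_{i,j} = 1/(1−q) when i+j = d+1, and u_{i,j} = 0 when i+j > d+1. Then 1 − Σ_{k=1}^d c_k = q^d, and with C = C̃ = diag(1, −c₁, …, −c_d), the identity Uᵗ C U C̃ = q^d I_{d+1} holds, so (q^d, C, C̃, U) ∈ 𝔐_d. -/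
open Finset Matrix

/-- entries of `U` -/
noncomputable def uEnt (d : ℕ) (q : ℂ) (i j : ℕ) : ℂ :=
  if i + j ≤ d then 1 else if i + j = d + 1 then 1 / (1 - q) else 0

lemma partial_sum (d : ℕ) (q : ℂ) (hq1 : q ≠ 1) (i j : ℕ) (hij : i ≤ j) (hj : j ≤ d) (n : ℕ) :
    1 - ∑ k ∈ Finset.range n, (1 - q) * q ^ k * uEnt d q (k + 1) i * uEnt d q (k + 1) j =
      if n + j ≤ d then q ^ n else if i = j then -q ^ (d - j + 1) / (1 - q) else 0 := by
  have h1 : (1 - q) ≠ 0 := sub_ne_zero.mpr (Ne.symm hq1)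
  induction n with
  | zero => simp [hj]
  | succ n ih =>
    rw [Finset.sum_range_succ, ← sub_sub, ih]
    rcases lt_trichotomy (n + j) d with h | h | h
    · have a1 : n + j ≤ d := by omega
      have a2 : n + 1 + j ≤ d := by omega
      have a3 : n + 1 + i ≤ d := by omega
      simp only [uEnt, a1, a2, a3, if_true]
      ring
    · have a1 : n + j ≤ d := by omega
      have a2 : ¬ n + 1 + j ≤ d := by omega
      have a4 : n + 1 + j = d + 1 := by omega
      have a5 : d - j = n := by omega
      by_cases e : i = j
      · subst e
        simp only [uEnt, a1, a2, a4, a5, if_true, if_false]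
        simp
        field_simp
        ring
      · have a3 : n + 1 + i ≤ d := by omega
        simp only [uEnt, a1, a2, a3, a4, e, if_true, if_false]
        simp
        field_simp
        ring
    · have a1 : ¬ n + j ≤ d := by omega
      have a2 : ¬ n + 1 + j ≤ d := by omega
      have a4 : ¬ n + 1 + j = d + 1 := by omega
      simp only [uEnt, a1, a2, a4, if_false]
      simp

lemma full_sum (d : ℕ) (q : ℂ) (hq1 : q ≠ 1) (i j : ℕ) (hi : i ≤ d) (hj : j ≤ d) :
    1 - ∑ k ∈ Finset.range d, (1 - q) * q ^ k * uEnt d q (k + 1) i * uEnt d q (k + 1) j =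
      if i = j then (if j = 0 then q ^ d else -q ^ (d - j + 1) / (1 - q)) else 0 := by
  rcases le_total i j with h | h
  · rw [partial_sum d q hq1 i j h hj]
    split_ifs <;> first | rfl | omega
  · have := partial_sum d q hq1 j i h hi d
    simp only [mul_right_comm _ (uEnt d q _ j) (uEnt d q _ i)] at this
    rw [this]
    split_ifs <;> first | rfl | omega | (subst_vars; rfl)

/-- Example 5.2: for `q ∉ {0,1}`, with `c_k = c̃_k = (1-q)q^{k-1}` (a `Fin d`-index `k`
encodes the index `k+1 ∈ {1,…,d}`) and `U` given by (5.4), one has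
`1 - Σ_{k=1}^d c_k = q^d` and `(q^d, C, C̃, U) ∈ 𝔐_d`. -/
theorem meixner_example52 (d : ℕ) (hd : 1 ≤ d) (q : ℂ) (hq0 : q ≠ 0) (hq1 : q ≠ 1) :
    (1 - ∑ k : Fin d, (1 - q) * q ^ (k : ℕ) = q ^ d) ∧
    MeixnerMem d (q ^ d)
      (fun k : Fin d => (1 - q) * q ^ (k : ℕ))
      (fun k : Fin d => (1 - q) * q ^ (k : ℕ))
      (Matrix.of fun i j : Fin (d + 1) =>
        if (i : ℕ) + (j : ℕ) ≤ d then 1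
        else if (i : ℕ) + (j : ℕ) = d + 1 then 1 / (1 - q)
        else 0) := by
  have h1 : (1 - q) ≠ 0 := sub_ne_zero.mpr (Ne.symm hq1)
  refine ⟨?_, pow_ne_zero _ hq0, ?_, ?_, ?_⟩
  · rw [← Finset.mul_sum, Fin.sum_univ_eq_sum_range (fun k => q ^ k) d, mul_neg_geom_sum]
    ring
  · intro j
    have : (j : ℕ) ≤ d := by omega
    simp [this]
  · intro j
    have : (j : ℕ) ≤ d := by omega
    simp [this]
  · ext i j
    have hi : (i : ℕ) ≤ d := by omega
    have hj : (j : ℕ) ≤ d := by omega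
    have key := full_sum d q hq1 i j hi hj
    rw [← Fin.sum_univ_eq_sum_range
      (fun k => (1 - q) * q ^ k * uEnt d q (k + 1) i * uEnt d q (k + 1) j) d] at key
    rw [Matrix.mul_diagonal, Matrix.mul_apply]
    simp only [Matrix.mul_diagonal, Matrix.transpose_apply, Matrix.of_apply]
    change (∑ k : Fin (d + 1), uEnt d q k i * _ * uEnt d q k j) * _ = _
    have e : (∑ k : Fin (d + 1), uEnt d q k i *
        (Fin.cons (1 : ℂ) (fun k : Fin d => -((1 - q) * q ^ (k : ℕ))) : Fin (d + 1) → ℂ) k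
        * uEnt d q k j) =
        1 - ∑ k : Fin d, (1 - q) * q ^ (k : ℕ) * uEnt d q (k + 1) i * uEnt d q (k + 1) j := by
      rw [Fin.sum_univ_succ, sub_eq_add_neg (1 : ℂ) (∑ k : Fin d, _), ← Finset.sum_neg_distrib]
      congr 1
      · simp [uEnt, hi, hj]
      · refine Finset.sum_congr rfl fun k _ => ?_
        simp only [Fin.cons_succ, Fin.val_succ]
        ring
    rw [e, key, Matrix.smul_apply, Matrix.one_apply]
    by_cases hij : i = j
    · subst hij
      refine Fin.cases ?_ (fun k => ?_) i
      · simp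
      · have hk : d = (d - (k + 1) + 1) + k := by omega
        simp only [Fin.cons_succ, Fin.val_succ, if_true, Nat.succ_ne_zero, if_false, smul_eq_mul]
        conv_rhs => rw [hk, pow_add]
        field_simp
    · have : (i : ℕ) ≠ j := fun h => hij (Fin.ext h)
      simp [hij, this]
end
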